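/- arXiv:2603.02193 — 2 statements merged into one kernel-verified Lean document; each statement's English description precedes it below -/
import Mathlib

section
/- Single-head self-attention is equivariant under permutations of token positions: for every Q, K, V : Matrix (Fin D) (Fin D) ℝ, every H : Matrix (Fin D) (Fin I) ℝ, and every σ : Equiv.Perm (Fin I), Attn (Pos σ H) = Pos σ (Attn H). -/
open Matrix BigOperators

noncomputable def softmax {n : ℕ} (x : Fin n → ℝ) : Fin n → ℝ :=
  fun i => Real.exp (x i) / ∑ j, Real.exp (x j)

def Pos {D I : ℕ} (σ : Equiv.Perm (Fin I)) (H : Matrix (Fin D) (Fin I) ℝ) :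
    Matrix (Fin D) (Fin I) ℝ :=
  fun d i => H d (σ i)

noncomputable def Attn {D I : ℕ} (Wq Wk Wv : Matrix (Fin D) (Fin D) ℝ)
    (H : Matrix (Fin D) (Fin I) ℝ) : Matrix (Fin D) (Fin I) ℝ :=
  fun d j =>
    ∑ i, (softmax (fun i' =>
        dotProduct (Wq.mulVec (fun d => H d j)) (Wk.mulVec (fun d => H d i')))) i *
      (Wv.mulVec (fun d' => H d' i)) d

def Colwise {D I : ℕ} (g : (Fin D → ℝ) → (Fin D → ℝ))
    (H : Matrix (Fin D) (Fin I) ℝ) : Matrix (Fin D) (Fin I) ℝ :=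
  fun d i => g (fun d' => H d' i) d

noncomputable def Layer {D I : ℕ} (Wq Wk Wv : Matrix (Fin D) (Fin D) ℝ)
    (norm m : (Fin D → ℝ) → (Fin D → ℝ))
    (H : Matrix (Fin D) (Fin I) ℝ) : Matrix (Fin D) (Fin I) ℝ :=
  let H' := Colwise norm (H + Attn Wq Wk Wv H)
  Colwise norm (H' + Colwise m H')

noncomputable def Block {D I : ℕ} (Wq Wk Wv : Matrix (Fin D) (Fin D) ℝ)
    (norm m : (Fin D → ℝ) → (Fin D → ℝ)) (L : ℕ) :
    Matrix (Fin D) (Fin I) ℝ → Matrix (Fin D) (Fin I) ℝ :=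
  (Layer Wq Wk Wv norm m)^[L]

theorem softmax_comp_perm {n : ℕ} (x : Fin n → ℝ) (σ : Equiv.Perm (Fin n)) (i : Fin n) :
    softmax (fun j => x (σ j)) i = softmax x (σ i) := by
  simp only [softmax, Equiv.sum_comp σ fun j => Real.exp (x j)]

theorem attn_position_equivariant {D I : ℕ}
    (Q K V : Matrix (Fin D) (Fin D) ℝ)
    (H : Matrix (Fin D) (Fin I) ℝ) (σ : Equiv.Perm (Fin I)) :
    Attn Q K V (Pos σ H) = Pos σ (Attn Q K V H) := by
  ext d j
  exact (Finset.sum_congr rfl fun i _ =>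
    congrArg (· * (V.mulVec fun d' => H d' (σ i)) d) (softmax_comp_perm _ σ i)).trans
    (Equiv.sum_comp σ fun i => softmax (fun i' =>
      dotProduct (Q.mulVec fun d => H d (σ j)) (K.mulVec fun d => H d i')) i *
      (V.mulVec fun d' => H d' i) d)
end

section
/- (Proposition 1: position equivariance of RRM blocks without positional embeddings.) For every L : ℕ, the L-layer RRM block commutes with column permutations: BlockL (Pos σ H) = Pos σ (BlockL H) for every σ : Equiv.Perm (Fin I) and every H. Consequently, for any finite symbol alphabet C, any embedding e : C → (Fin D → ℝ) applied elementwise via (Ec X) d i = e (X i) d, any real coefficients α, β, any input X : Fin I → C, and any matrices Z', Z : Matrix (Fin D) (Fin I) ℝ: BlockL (α • Ec (fun i => X (σ i)) + β • Pos σ Z' + Pos σ Z) = Pos σ (BlockL (α • Ec X + β • Z' + Z)). -/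
open Matrix BigOperators

def Ec {D I : ℕ} {C : Type*} (e : C → Fin D → ℝ) (X : Fin I → C) :
    Matrix (Fin D) (Fin I) ℝ :=
  fun d i => e (X i) d

theorem Pos_add {D I : ℕ} (σ : Equiv.Perm (Fin I)) (H₁ H₂ : Matrix (Fin D) (Fin I) ℝ) :
    Pos σ (H₁ + H₂) = Pos σ H₁ + Pos σ H₂ := rfl

theorem Pos_smul {D I : ℕ} (σ : Equiv.Perm (Fin I)) (a : ℝ) (H : Matrix (Fin D) (Fin I) ℝ) :
    Pos σ (a • H) = a • Pos σ H := rfl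

theorem Ec_comp_perm {D I : ℕ} {C : Type*} (e : C → Fin D → ℝ) (X : Fin I → C)
    (σ : Equiv.Perm (Fin I)) :
    Ec e (fun i => X (σ i)) = Pos σ (Ec e X) := rfl

theorem Colwise_Pos {D I : ℕ} (g : (Fin D → ℝ) → (Fin D → ℝ)) (σ : Equiv.Perm (Fin I))
    (H : Matrix (Fin D) (Fin I) ℝ) :
    Colwise g (Pos σ H) = Pos σ (Colwise g H) := rfl

theorem Attn_Pos {D I : ℕ} (Wq Wk Wv : Matrix (Fin D) (Fin D) ℝ) (σ : Equiv.Perm (Fin I))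
    (H : Matrix (Fin D) (Fin I) ℝ) :
    Attn Wq Wk Wv (Pos σ H) = Pos σ (Attn Wq Wk Wv H) := by
  ext d j
  let s : Fin I → ℝ := fun i =>
    dotProduct (Wq.mulVec fun d => H d (σ j)) (Wk.mulVec fun d => H d i)
  let v : Fin I → ℝ := fun i => Wv.mulVec (fun d' => H d' i) d
  change ∑ i, softmax (fun i' => s (σ i')) i * v (σ i) = ∑ i, softmax s i * v i
  simp only [softmax_comp_perm]
  exact Equiv.sum_comp σ fun i => softmax s i * v i

theorem Layer_Pos {D I : ℕ} (Wq Wk Wv : Matrix (Fin D) (Fin D) ℝ)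
    (norm m : (Fin D → ℝ) → (Fin D → ℝ)) (σ : Equiv.Perm (Fin I))
    (H : Matrix (Fin D) (Fin I) ℝ) :
    Layer Wq Wk Wv norm m (Pos σ H) = Pos σ (Layer Wq Wk Wv norm m H) := by
  simp only [Layer, Attn_Pos, ← Pos_add, Colwise_Pos]

theorem Block_Pos {D I : ℕ} (Wq Wk Wv : Matrix (Fin D) (Fin D) ℝ)
    (norm m : (Fin D → ℝ) → (Fin D → ℝ)) (L : ℕ) (σ : Equiv.Perm (Fin I))
    (H : Matrix (Fin D) (Fin I) ℝ) :
    Block Wq Wk Wv norm m L (Pos σ H) = Pos σ (Block Wq Wk Wv norm m L H) :=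
  Function.Commute.iterate_left (g := Pos σ) (Layer_Pos Wq Wk Wv norm m σ) L H

theorem rrm_block_position_equivariant {D I : ℕ}
    (Wq Wk Wv : Matrix (Fin D) (Fin D) ℝ)
    (norm m : (Fin D → ℝ) → (Fin D → ℝ)) (L : ℕ)
    (C : Type*) [Fintype C] (e : C → Fin D → ℝ) :
    (∀ (σ : Equiv.Perm (Fin I)) (H : Matrix (Fin D) (Fin I) ℝ),
      Block Wq Wk Wv norm m L (Pos σ H) = Pos σ (Block Wq Wk Wv norm m L H)) ∧
    (∀ (α β : ℝ) (X : Fin I → C) (Z' Z : Matrix (Fin D) (Fin I) ℝ)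
        (σ : Equiv.Perm (Fin I)),
      Block Wq Wk Wv norm m L (α • Ec e (fun i => X (σ i)) + β • Pos σ Z' + Pos σ Z)
        = Pos σ (Block Wq Wk Wv norm m L (α • Ec e X + β • Z' + Z))) := by
  refine ⟨Block_Pos Wq Wk Wv norm m L, fun α β X Z' Z σ => ?_⟩
  rw [← Block_Pos, Pos_add, Pos_add, Pos_smul, Pos_smul, Ec_comp_perm]
end
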